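/- Let A(·, z) be a smooth solution of ∂A/∂z + iΔA = 0 on the annulus Ω = {r < ρ < R} with oblique derivative boundary conditions ρ ∂A/∂ρ = tan α · ∂A/∂θ on both boundary circles. Then (1/2) d/dz ‖A(·, z)‖²_{L²(Ω)} = tan α · [ |γ_R A|²_{H^{1/2}(S¹)} − |γ_r A|²_{H^{1/2}(S¹)} ], where γ_R, γ_r are the traces on the outer and inner circles and |v|²_{H^{1/2}(S¹)} = Σ_{n∈ℤ} n |v_n|² for v = Σ_n v_n e^{inθ}/√(2π). -/

import Mathlib

open MeasureTheory

/-- The open annulus `{r < |p| < R}` in `ℝ²`. -/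
def annulus (r R : ℝ) : Set (ℝ × ℝ) :=
  {p | r < Real.sqrt (p.1 ^ 2 + p.2 ^ 2) ∧ Real.sqrt (p.1 ^ 2 + p.2 ^ 2) < R}

/-- Partial derivative in the x-direction. -/
noncomputable def px (u : ℝ × ℝ → ℂ) (p : ℝ × ℝ) : ℂ := fderiv ℝ u p (1, 0)

/-- Partial derivative in the y-direction. -/
noncomputable def py (u : ℝ × ℝ → ℂ) (p : ℝ × ℝ) : ℂ := fderiv ℝ u p (0, 1)

/-- `n`-th Fourier coefficient (normalization `e^{inθ}/√(2π)`) of the trace of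
`A(·, z)` on the circle of radius `ρ`. -/
noncomputable def tcoef (A : ℝ × ℝ → ℝ → ℂ) (ρ : ℝ) (n : ℤ) (z : ℝ) : ℂ :=
  (1 / Real.sqrt (2 * Real.pi) : ℝ) *
    ∫ θ in (0 : ℝ)..(2 * Real.pi),
      A (ρ * Real.cos θ, ρ * Real.sin θ) z * Complex.exp (-Complex.I * n * θ)

/-- The (signed) `H^{1/2}(S¹)` quadratic form `|v|² = Σ_{n∈ℤ} n |v_n|²`. -/
noncomputable def hHalfSq (c : ℤ → ℂ) : ℝ := ∑' n : ℤ, (n : ℝ) * ‖c n‖ ^ 2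

lemma fourier_aux (v w : ℝ → ℂ) (hv : ∀ θ, HasDerivAt v (w θ) θ)
    (hvp : Function.Periodic v (2 * Real.pi)) (hw : Continuous w)
    (hwp : Function.Periodic w (2 * Real.pi)) :
    hHalfSq (fun n : ℤ => (1 / Real.sqrt (2 * Real.pi) : ℝ) *
      ∫ θ in (0 : ℝ)..(2 * Real.pi), v θ * Complex.exp (-Complex.I * n * θ))
      = ∫ θ in (0 : ℝ)..(2 * Real.pi), ((starRingEnd ℂ) (v θ) * w θ).im := by
  have hpi : (0 : ℝ) < 2 * Real.pi := Real.two_pi_pos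
  have : Fact (0 < 2 * Real.pi) := ⟨hpi⟩
  have hvc : Continuous v := continuous_iff_continuousAt.2 fun x => (hv x).continuousAt
  let V : C(AddCircle (2 * Real.pi), ℂ) :=
    ⟨hvp.lift, continuous_coinduced_dom.2 hvc⟩
  let W : C(AddCircle (2 * Real.pi), ℂ) :=
    ⟨hwp.lift, continuous_coinduced_dom.2 hw⟩
  have hVx : ∀ x : ℝ, V (x : AddCircle (2 * Real.pi)) = v x := fun x => hvp.lift_coe x
  have hWx : ∀ x : ℝ, W (x : AddCircle (2 * Real.pi)) = w x := fun x => hwp.lift_coe x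
  have hfour : ∀ (n : ℤ) (x : ℝ), @fourier (2 * Real.pi) (-n) (x : AddCircle (2 * Real.pi))
      = Complex.exp (-Complex.I * n * x) := by
    intro n x
    rw [fourier_coe_apply]
    congr 1
    have : (Real.pi : ℂ) ≠ 0 := by exact_mod_cast Real.pi_ne_zero
    push_cast
    field_simp
  set c : ℤ → ℂ := fun n => ∫ θ in (0 : ℝ)..(2 * Real.pi), v θ * Complex.exp (-Complex.I * n * θ)
    with hc
  have hcV : ∀ n, fourierCoeff V n = (1 / (2 * Real.pi) : ℝ) * c n := by
    intro n
    rw [fourierCoeff_eq_intervalIntegral V n 0, zero_add, Complex.real_smul, hc]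
    simp only [hVx, hfour, smul_eq_mul, mul_comm]
  have hcW : ∀ n, fourierCoeff W n = (1 / (2 * Real.pi) : ℝ) * (Complex.I * n * c n) := by
    intro n
    rw [fourierCoeff_eq_intervalIntegral W n 0, zero_add, Complex.real_smul]
    congr 1
    simp only [hWx, hfour, smul_eq_mul]
    have he : ∀ x : ℝ, HasDerivAt (fun x : ℝ => Complex.exp (-Complex.I * n * x))
        (Complex.exp (-Complex.I * n * x) * (-Complex.I * n)) x := by
      intro x
      have h1 : HasDerivAt (fun x : ℝ => -Complex.I * n * (x : ℂ)) (-Complex.I * n * 1) x :=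
        (Complex.ofRealCLM.hasDerivAt).const_mul _
      simpa using h1.cexp
    have := intervalIntegral.integral_mul_deriv_eq_deriv_mul (a := 0) (b := 2 * Real.pi)
      (fun x _ => he x) (fun x _ => hv x)
      (Continuous.intervalIntegrable (by fun_prop) _ _) (hw.intervalIntegrable _ _)
    rw [this]
    have e1 : Complex.exp (-Complex.I * n * ((2 * Real.pi : ℝ) : ℂ)) = 1 := by
      rw [Complex.exp_eq_one_iff]
      exact ⟨-n, by push_cast; ring⟩
    have e2 : v (2 * Real.pi) = v 0 := by simpa using hvp 0
    rw [e1, e2, hc]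
    simp only [Complex.ofReal_zero, mul_zero, Complex.exp_zero, sub_self, zero_sub]
    rw [← intervalIntegral.integral_const_mul, ← intervalIntegral.integral_neg]
    congr 1
    ext x
    ring
  have hP := (@fourierBasis (2 * Real.pi) _).hasSum_inner_mul_inner
    (ContinuousMap.toLp (E := ℂ) 2 AddCircle.haarAddCircle ℂ V)
    (ContinuousMap.toLp (E := ℂ) 2 AddCircle.haarAddCircle ℂ W)
  rw [ContinuousMap.inner_toLp, AddCircle.integral_haarAddCircle,
    ← AddCircle.intervalIntegral_preimage _ 0, zero_add] at hP
  have ht : ∀ i, inner ℂ (ContinuousMap.toLp (E := ℂ) 2 AddCircle.haarAddCircle ℂ V)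
      (fourierBasis i) * inner ℂ (fourierBasis i)
      (ContinuousMap.toLp (E := ℂ) 2 AddCircle.haarAddCircle ℂ W)
      = (starRingEnd ℂ) (fourierCoeff V i) * fourierCoeff W i := by
    intro i
    rw [← inner_conj_symm, ← HilbertBasis.repr_apply_apply, ← HilbertBasis.repr_apply_apply,
      fourierBasis_repr, fourierBasis_repr, fourierCoeff_toLp, fourierCoeff_toLp]
  simp only [ht, hcV, hcW, hVx, hWx] at hP
  have hP2 := (Complex.hasSum_im hP).mul_left (2 * Real.pi)
  unfold hHalfSq
  have hcont : Continuous fun θ => (starRingEnd ℂ) (v θ) * w θ :=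
    (Complex.continuous_conj.comp hvc).mul hw
  have him : ∫ θ in (0 : ℝ)..(2 * Real.pi), ((starRingEnd ℂ) (v θ) * w θ).im
      = (∫ θ in (0 : ℝ)..(2 * Real.pi), (starRingEnd ℂ) (v θ) * w θ).im := by
    simpa using (Complex.imCLM.intervalIntegral_comp_comm (μ := volume)
      (hcont.intervalIntegrable 0 (2 * Real.pi)))
  rw [him]
  convert hP2.tsum_eq using 1
  · congr 1
    ext n
    have h4 : (starRingEnd ℂ) ((1 / (2 * Real.pi) : ℝ) * c n) *
      ((1 / (2 * Real.pi) : ℝ) * (Complex.I * n * c n)) =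
      (((1 / (2 * Real.pi)) ^ 2 * n * ‖c n‖ ^ 2 : ℝ) : ℂ) * Complex.I := by
      rw [map_mul, Complex.conj_ofReal]
      have := Complex.conj_mul' (c n)
      push_cast
      rw [← this]
      ring
    rw [h4, Complex.im_ofReal_mul]
    change (n : ℝ) * ‖((1 / Real.sqrt (2 * Real.pi) : ℝ) : ℂ) * c n‖ ^ 2 = _
    clear_value c
    rw [Complex.I_im, norm_mul, mul_pow, Complex.norm_real, Real.norm_eq_abs, sq_abs, div_pow,
      Real.sq_sqrt hpi.le]
    have := hpi.ne'
    field_simp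
  · simp only [Complex.real_smul, Complex.im_ofReal_mul]
    rw [← mul_assoc, mul_inv_cancel₀ hpi.ne', one_mul]
    simp only [mul_comm]

lemma div_aux (r R : ℝ) (hr : 0 < r) (hrR : r < R) (F G : ℝ × ℝ → ℝ)
    (hF : ContDiff ℝ 1 F) (hG : ContDiff ℝ 1 G) :
    ∫ p in annulus r R, (fderiv ℝ F p (1, 0) + fderiv ℝ G p (0, 1)) =
      (∫ θ in (0 : ℝ)..(2 * Real.pi), R * (F (R * Real.cos θ, R * Real.sin θ) * Real.cos θ
        + G (R * Real.cos θ, R * Real.sin θ) * Real.sin θ)) -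
      ∫ θ in (0 : ℝ)..(2 * Real.pi), r * (F (r * Real.cos θ, r * Real.sin θ) * Real.cos θ
        + G (r * Real.cos θ, r * Real.sin θ) * Real.sin θ) := by
  set f : ℝ × ℝ → ℝ := fun x => x.1 * (F (x.1 * Real.cos x.2, x.1 * Real.sin x.2) * Real.cos x.2
        + G (x.1 * Real.cos x.2, x.1 * Real.sin x.2) * Real.sin x.2) with hf
  set g : ℝ × ℝ → ℝ := fun x => -F (x.1 * Real.cos x.2, x.1 * Real.sin x.2) * Real.sin x.2
        + G (x.1 * Real.cos x.2, x.1 * Real.sin x.2) * Real.cos x.2 with hg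
  set D : ℝ × ℝ → ℝ := fun p => fderiv ℝ F p (1, 0) + fderiv ℝ G p (0, 1) with hD
  have hDc : Continuous D :=
    ((hF.continuous_fderiv (by norm_num)).clm_apply continuous_const).add
      ((hG.continuous_fderiv (by norm_num)).clm_apply continuous_const)
  have hfC : ContDiff ℝ 1 f := by fun_prop
  have hgC : ContDiff ℝ 1 g := by fun_prop
  have hlin : ∀ (L : ℝ × ℝ →L[ℝ] ℝ) (a b : ℝ), L (a, b) = a * L (1, 0) + b * L (0, 1) := by
    intro L a b
    have : ((a, b) : ℝ × ℝ) = a • (1, 0) + b • (0, 1) := by simp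
    rw [this, map_add, map_smul, map_smul]; simp
  have key : ∀ x : ℝ × ℝ, fderiv ℝ f x (1, 0) + fderiv ℝ g x (0, 1)
      = x.1 * D (x.1 * Real.cos x.2, x.1 * Real.sin x.2) := by
    rintro ⟨ρ, θ⟩
    have hP1 : HasDerivAt (fun t : ℝ => ((t * Real.cos θ, t * Real.sin θ) : ℝ × ℝ))
        (1 * Real.cos θ, 1 * Real.sin θ) ρ :=
      ((hasDerivAt_id ρ).mul_const _).prodMk ((hasDerivAt_id ρ).mul_const _)
    have hP2 : HasDerivAt (fun t : ℝ => ((ρ * Real.cos t, ρ * Real.sin t) : ℝ × ℝ))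
        (ρ * -Real.sin θ, ρ * Real.cos θ) θ :=
      ((Real.hasDerivAt_cos θ).const_mul _).prodMk ((Real.hasDerivAt_sin θ).const_mul _)
    have dF := fun p => ((hF.differentiable (by norm_num)) p).hasFDerivAt
    have dG := fun p => ((hG.differentiable (by norm_num)) p).hasFDerivAt
    have h1 : HasDerivAt (fun t : ℝ => f (t, θ)) _ ρ :=
      (hasDerivAt_id ρ).mul ((((dF (ρ * Real.cos θ, ρ * Real.sin θ)).comp_hasDerivAt ρ hP1).mul_const
        (Real.cos θ)).add (((dG (ρ * Real.cos θ, ρ * Real.sin θ)).comp_hasDerivAt ρ hP1).mul_const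
        (Real.sin θ)))
    have h2 : HasDerivAt (fun t : ℝ => g (ρ, t)) _ θ :=
      ((((dF (ρ * Real.cos θ, ρ * Real.sin θ)).comp_hasDerivAt θ hP2).neg.mul
        (Real.hasDerivAt_sin θ))).add
        (((dG (ρ * Real.cos θ, ρ * Real.sin θ)).comp_hasDerivAt θ hP2).mul
        (Real.hasDerivAt_cos θ))
    have h1' : HasDerivAt (fun t : ℝ => f (t, θ)) (fderiv ℝ f (ρ, θ) (1, 0)) ρ :=
      HasFDerivAt.comp_hasDerivAt (f := fun t : ℝ => ((t, θ) : ℝ × ℝ)) ρ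
        ((hfC.differentiable (by norm_num)) (ρ, θ)).hasFDerivAt ((hasDerivAt_id ρ).prodMk (hasDerivAt_const ρ θ))
    have h2' : HasDerivAt (fun t : ℝ => g (ρ, t)) (fderiv ℝ g (ρ, θ) (0, 1)) θ :=
      HasFDerivAt.comp_hasDerivAt (f := fun t : ℝ => ((ρ, t) : ℝ × ℝ)) θ
        ((hgC.differentiable (by norm_num)) (ρ, θ)).hasFDerivAt ((hasDerivAt_const θ ρ).prodMk (hasDerivAt_id θ))
    rw [h1'.unique h1, h2'.unique h2]
    simp only [hD, id]
    rw [hlin (fderiv ℝ F _) (1 * Real.cos θ), hlin (fderiv ℝ F _) (ρ * -Real.sin θ),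
      hlin (fderiv ℝ G _) (1 * Real.cos θ), hlin (fderiv ℝ G _) (ρ * -Real.sin θ)]
    have hcs := Real.sin_sq_add_cos_sq θ
    have hs : Real.sin θ ^ 2 = 1 - Real.cos θ ^ 2 := by linarith
    ring_nf
    simp only [hs]
    ring
  have hdiv := integral_divergence_prod_Icc_of_hasFDerivAt_of_le f g (fderiv ℝ f) (fderiv ℝ g)
    (r, -Real.pi) (R, Real.pi) ⟨hrR.le, by simp; linarith [Real.pi_pos]⟩
    hfC.continuous.continuousOn hgC.continuous.continuousOn
    (fun x _ => (hfC.differentiable (by norm_num) x).hasFDerivAt)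
    (fun x _ => (hgC.differentiable (by norm_num) x).hasFDerivAt)
    (by
      simp only [key]
      apply Continuous.integrableOn_Icc
      fun_prop)
  simp only [key] at hdiv
  have hg0 : ∀ x : ℝ, g (x, Real.pi) = g (x, -Real.pi) := by intro x; simp [hg]
  simp only [hg0, sub_self, zero_add] at hdiv
  have hper : ∀ ρ : ℝ, ∫ y in -Real.pi..Real.pi, f (ρ, y) = ∫ y in (0:ℝ)..(2*Real.pi), f (ρ, y) := by
    intro ρ
    have hp : Function.Periodic (fun y => f (ρ, y)) (2 * Real.pi) := by
      intro y; simp [hf]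
    have := hp.intervalIntegral_add_eq (-Real.pi) 0
    rw [zero_add] at this
    rw [← this]; congr 1; ring
  rw [hper, hper] at hdiv
  have hmeas : MeasurableSet (annulus r R) := by
    apply IsOpen.measurableSet
    have hc : Continuous fun p : ℝ × ℝ => Real.sqrt (p.1 ^ 2 + p.2 ^ 2) := by fun_prop
    exact (isOpen_lt continuous_const hc).inter (isOpen_lt hc continuous_const)
  rw [← integral_indicator hmeas, ← integral_comp_polarCoord_symm]
  refine Eq.trans ?_ hdiv
  have hIcc : Set.Icc ((r, -Real.pi) : ℝ × ℝ) (R, Real.pi) =ᵐ[volume]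
      Set.Ioo r R ×ˢ Set.Ioo (-Real.pi) Real.pi := by
    rw [Set.Icc_prod_eq]
    exact Measure.set_prod_ae_eq Ioo_ae_eq_Icc.symm Ioo_ae_eq_Icc.symm
  rw [setIntegral_congr_set hIcc, ← integral_indicator (measurableSet_Ioo.prod measurableSet_Ioo),
    ← integral_indicator polarCoord.open_target.measurableSet]
  congr 1
  ext ⟨ρ, θ⟩
  have hsq : ∀ ρ : ℝ, 0 < ρ → ∀ θ, Real.sqrt ((ρ * Real.cos θ)^2 + (ρ * Real.sin θ)^2) = ρ := by
    intro ρ h θ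
    rw [show (ρ * Real.cos θ)^2 + (ρ * Real.sin θ)^2 = ρ^2 by
      nlinarith [Real.sin_sq_add_cos_sq θ], Real.sqrt_sq h.le]
  by_cases h0 : 0 < ρ
  · have := hsq ρ h0 θ
    simp only [Set.indicator, polarCoord_target, polarCoord_symm_apply, annulus, Set.mem_prod,
      Set.mem_Ioi, Set.mem_Ioo, Set.mem_ofPred_eq, this, h0, true_and, smul_eq_mul]
    by_cases h1 : -Real.pi < θ ∧ θ < Real.pi <;> by_cases h2 : r < ρ ∧ ρ < R <;>
      simp only [h1, h2, hD, if_true, if_false, mul_zero, and_true, and_false, and_self]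
  · have h1 : ¬ r < ρ := by intro h; exact h0 (hr.trans h)
    simp [Set.indicator, h0, h1]

lemma fderiv_im_aux (u w : ℝ × ℝ → ℂ) (hu : Differentiable ℝ u) (hw : Differentiable ℝ w)
    (p e : ℝ × ℝ) :
    fderiv ℝ (fun q => ((starRingEnd ℂ) (u q) * w q).im) p e
      = ((starRingEnd ℂ) (fderiv ℝ u p e) * w p + (starRingEnd ℂ) (u p) * fderiv ℝ w p e).im := by
  have h1 : HasFDerivAt (fun q => (starRingEnd ℂ) (u q))
      ((Complex.conjCLE : ℂ →L[ℝ] ℂ).comp (fderiv ℝ u p)) p :=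
    (Complex.conjCLE : ℂ →L[ℝ] ℂ).hasFDerivAt.comp p (hu p).hasFDerivAt
  have h2 := h1.mul (hw p).hasFDerivAt
  have h3 : HasFDerivAt (fun q => ((starRingEnd ℂ) (u q) * w q).im) _ p :=
    Complex.imCLM.hasFDerivAt.comp p h2
  rw [h3.fderiv]
  simp
  ring

lemma deriv_int_aux (r R : ℝ) (A : ℝ × ℝ → ℝ → ℂ)
    (hA : ContDiff ℝ (⊤ : ℕ∞) fun q : (ℝ × ℝ) × ℝ => A q.1 q.2) (z : ℝ) :
    deriv (fun z' => ∫ p in annulus r R, ‖A p z'‖ ^ 2) z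
      = ∫ p in annulus r R, 2 * ((starRingEnd ℂ) (A p z) * deriv (fun z' => A p z') z).re := by
  have hAd : ∀ p z, HasDerivAt (fun z' => A p z')
      (fderiv ℝ (fun q : (ℝ × ℝ) × ℝ => A q.1 q.2) (p, z) (0, 1)) z := by
    intro p z
    exact HasFDerivAt.comp_hasDerivAt (f := fun t : ℝ => ((p, t) : (ℝ × ℝ) × ℝ)) z
        ((hA.differentiable (by simp)) (p, z)).hasFDerivAt
        ((hasDerivAt_const z p).prodMk (hasDerivAt_id z))
  have hAc : Continuous fun q : (ℝ × ℝ) × ℝ => A q.1 q.2 := hA.continuous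
  have hA'c : Continuous fun q : (ℝ × ℝ) × ℝ => deriv (fun z' => A q.1 z') q.2 := by
    have : (fun q : (ℝ × ℝ) × ℝ => deriv (fun z' => A q.1 z') q.2)
        = fun q => fderiv ℝ (fun q : (ℝ × ℝ) × ℝ => A q.1 q.2) q (0, 1) := by
      ext q; exact (hAd q.1 q.2).deriv
    rw [this]
    exact (hA.continuous_fderiv (by simp)).clm_apply continuous_const
  set F' : ℝ → ℝ × ℝ → ℝ := fun z p =>
    2 * ((starRingEnd ℂ) (A p z) * deriv (fun z' => A p z') z).re with hF'
  have hF'c : Continuous fun q : (ℝ × ℝ) × ℝ => F' q.2 q.1 :=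
    continuous_const.mul (Complex.continuous_re.comp ((Complex.continuous_conj.comp hAc).mul hA'c))
  have hFc : Continuous fun q : (ℝ × ℝ) × ℝ => ‖A q.1 q.2‖ ^ 2 := hAc.norm.pow 2
  have hmeas : MeasurableSet (annulus r R) := by
    apply IsOpen.measurableSet
    have hc : Continuous fun p : ℝ × ℝ => Real.sqrt (p.1 ^ 2 + p.2 ^ 2) := by fun_prop
    exact (isOpen_lt continuous_const hc).inter (isOpen_lt hc continuous_const)
  have hsub : annulus r R ⊆ Set.Icc (-R) R ×ˢ Set.Icc (-R) R := by
    rintro ⟨x, y⟩ ⟨-, h⟩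
    have h1 : |x| ≤ Real.sqrt (x ^ 2 + y ^ 2) := Real.abs_le_sqrt (by nlinarith [sq_nonneg y])
    have h2 : |y| ≤ Real.sqrt (x ^ 2 + y ^ 2) := Real.abs_le_sqrt (by nlinarith [sq_nonneg x])
    exact ⟨abs_le.1 (h1.trans h.le), abs_le.1 (h2.trans h.le)⟩
  have hK : IsCompact (Set.Icc (-R) R ×ˢ Set.Icc (-R) R) := isCompact_Icc.prod isCompact_Icc
  obtain ⟨C, hC⟩ := (hK.prod (isCompact_Icc (a := z - 1) (b := z + 1))).exists_bound_of_continuousOn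
    hF'c.continuousOn
  have hfin : volume (annulus r R) ≠ ⊤ :=
    ((measure_mono hsub).trans_lt hK.measure_lt_top).ne
  refine (hasDerivAt_integral_of_dominated_loc_of_deriv_le (μ := volume.restrict (annulus r R))
    (F := fun z' p => ‖A p z'‖ ^ 2) (F' := F') (bound := fun _ => C)
    (s := Set.Icc (z - 1) (z + 1))
    (Icc_mem_nhds (by linarith) (by linarith)) ?_ ?_ ?_ ?_ ?_ ?_).2.deriv
  · refine Filter.Eventually.of_forall fun x => ?_
    exact (hFc.comp (Continuous.prodMk_left x)).aestronglyMeasurable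
  · exact ((hFc.comp (Continuous.prodMk_left z)).continuousOn.integrableOn_compact hK).mono_set hsub
  · exact (hF'c.comp (Continuous.prodMk_left z)).aestronglyMeasurable
  · refine (ae_restrict_iff' hmeas).2 (Filter.Eventually.of_forall fun p hp x hx => ?_)
    exact hC (p, x) ⟨hsub hp, hx⟩
  · exact integrableOn_const hfin
  · refine Filter.Eventually.of_forall fun p x _ => ?_
    have h := (hAd p x).differentiableAt.hasDerivAt
    have h2 := h.norm_sq
    have h3 : F' x p = 2 * inner ℝ (A p x) (deriv (fun z' => A p z') x) := by
      rw [Complex.inner, mul_comm (deriv _ x)]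
    rw [h3]
    exact h2

/-- For a smooth solution of `∂A/∂z + iΔA = 0` on the annulus with oblique derivative
boundary conditions `ρ ∂A/∂ρ = tan α · ∂A/∂θ` on both boundary circles,
`(1/2) d/dz ‖A‖²_{L²} = tan α [ |γ_R A|²_{H^{1/2}} − |γ_r A|²_{H^{1/2}} ]`. -/
theorem stmt_7 (r R α : ℝ) (hr : 0 < r) (hrR : r < R)
    (A : ℝ × ℝ → ℝ → ℂ)
    (hA : ContDiff ℝ (⊤ : ℕ∞) fun q : (ℝ × ℝ) × ℝ => A q.1 q.2)
    (heq : ∀ p ∈ annulus r R, ∀ z : ℝ,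
      deriv (fun z' => A p z') z
        + Complex.I * (px (px fun q => A q z) p + py (py fun q => A q z) p) = 0)
    (hbc : ∀ p : ℝ × ℝ, ∀ z : ℝ,
      (Real.sqrt (p.1 ^ 2 + p.2 ^ 2) = r ∨ Real.sqrt (p.1 ^ 2 + p.2 ^ 2) = R) →
      fderiv ℝ (fun q => A q z) p p
        = (Real.tan α : ℂ) * fderiv ℝ (fun q => A q z) p (-p.2, p.1)) :
    ∀ z : ℝ,
      (1 / 2) * deriv (fun z' => ∫ p in annulus r R, ‖A p z'‖ ^ 2) z
        = Real.tan α *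
            (hHalfSq (fun n => tcoef A R n z) - hHalfSq fun n => tcoef A r n z) := by
  intro z
  set u : ℝ × ℝ → ℂ := fun q => A q z with hu
  have huC : ContDiff ℝ (⊤ : ℕ∞) u := hA.comp (contDiff_id.prodMk contDiff_const)
  have hpC : ∀ (e : ℝ × ℝ) (w : ℝ × ℝ → ℂ), ContDiff ℝ (⊤ : ℕ∞) w →
      ContDiff ℝ (⊤ : ℕ∞) fun p => fderiv ℝ w p e := by
    intro e w hw
    exact (hw.fderiv_right (by simp)).clm_apply contDiff_const
  have hxC : ContDiff ℝ (⊤ : ℕ∞) (px u) := hpC _ _ huC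
  have hyC : ContDiff ℝ (⊤ : ℕ∞) (py u) := hpC _ _ huC
  have hud := huC.differentiable (by simp)
  have hFC : ∀ w : ℝ × ℝ → ℂ, ContDiff ℝ (⊤ : ℕ∞) w →
      ContDiff ℝ 1 fun q => ((starRingEnd ℂ) (u q) * w q).im := by
    intro w hw
    have h1 : ContDiff ℝ (⊤ : ℕ∞) fun q => (starRingEnd ℂ) (u q) :=
      (Complex.conjCLE : ℂ →L[ℝ] ℂ).contDiff.comp huC
    exact (Complex.imCLM.contDiff.comp (h1.mul hw)).of_le (by exact_mod_cast le_top)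
  have hdiv := div_aux r R hr hrR _ _ (hFC _ hxC) (hFC _ hyC)
  have hmeas : MeasurableSet (annulus r R) := by
    apply IsOpen.measurableSet
    have hc : Continuous fun p : ℝ × ℝ => Real.sqrt (p.1 ^ 2 + p.2 ^ 2) := by fun_prop
    exact (isOpen_lt continuous_const hc).inter (isOpen_lt hc continuous_const)
  have hlin : ∀ (L : ℝ × ℝ →L[ℝ] ℂ) (a b : ℝ), L (a, b) = a * L (1, 0) + b * L (0, 1) := by
    intro L a b
    have : ((a, b) : ℝ × ℝ) = a • (1, 0) + b • (0, 1) := by simp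
    rw [this, map_add, map_smul, map_smul]; simp
  have hbd : ∀ ρ : ℝ, 0 < ρ → (ρ = r ∨ ρ = R) →
      ∫ θ in (0 : ℝ)..(2 * Real.pi),
        ρ * (((starRingEnd ℂ) (u (ρ * Real.cos θ, ρ * Real.sin θ)) *
          px u (ρ * Real.cos θ, ρ * Real.sin θ)).im * Real.cos θ
        + ((starRingEnd ℂ) (u (ρ * Real.cos θ, ρ * Real.sin θ)) *
          py u (ρ * Real.cos θ, ρ * Real.sin θ)).im * Real.sin θ)
      = Real.tan α * hHalfSq (fun n => tcoef A ρ n z) := by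
    intro ρ hρ hρr
    have hP2 : ∀ θ : ℝ, HasDerivAt (fun t : ℝ => ((ρ * Real.cos t, ρ * Real.sin t) : ℝ × ℝ))
        (ρ * -Real.sin θ, ρ * Real.cos θ) θ := fun θ =>
      ((Real.hasDerivAt_cos θ).const_mul _).prodMk ((Real.hasDerivAt_sin θ).const_mul _)
    have hF := fourier_aux (fun θ => u (ρ * Real.cos θ, ρ * Real.sin θ))
      (fun θ => fderiv ℝ u (ρ * Real.cos θ, ρ * Real.sin θ) (ρ * -Real.sin θ, ρ * Real.cos θ))
      (fun θ => (hud _).hasFDerivAt.comp_hasDerivAt θ (hP2 θ))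
      (by intro θ; simp)
      (by
        refine ((huC.continuous_fderiv (by simp)).comp ?_).clm_apply ?_ <;> fun_prop)
      (by intro θ; simp)
    unfold tcoef
    rw [hF, ← intervalIntegral.integral_const_mul]
    congr 1
    ext θ
    have hsq : Real.sqrt ((ρ * Real.cos θ)^2 + (ρ * Real.sin θ)^2) = ρ := by
      rw [show (ρ * Real.cos θ)^2 + (ρ * Real.sin θ)^2 = ρ^2 by
        nlinarith [Real.sin_sq_add_cos_sq θ], Real.sqrt_sq hρ.le]
    have hb := hbc (ρ * Real.cos θ, ρ * Real.sin θ) z (by simpa only [hsq] using hρr)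
    simp only at hb
    have hb2 : fderiv ℝ u (ρ * Real.cos θ, ρ * Real.sin θ) (ρ * Real.cos θ, ρ * Real.sin θ)
      = (Real.tan α : ℂ) * fderiv ℝ u (ρ * Real.cos θ, ρ * Real.sin θ)
          (ρ * -Real.sin θ, ρ * Real.cos θ) := by
      rw [mul_neg]; exact hb
    rw [← Complex.im_ofReal_mul, mul_left_comm, ← hb2, hlin _ (ρ * Real.cos θ)]
    simp only [px, py, Complex.mul_im, Complex.add_im, Complex.mul_re, Complex.add_re,
      Complex.ofReal_re, Complex.ofReal_im, Complex.conj_re, Complex.conj_im]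
    ring
  rw [hbd R (hr.trans hrR) (Or.inr rfl), hbd r hr (Or.inl rfl)] at hdiv
  rw [mul_sub, ← hdiv, deriv_int_aux r R A hA z, ← integral_const_mul]
  refine setIntegral_congr_fun hmeas fun p hp => ?_
  have he := heq p hp z
  have he2 : deriv (fun z' => A p z') z = -(Complex.I * (px (px u) p + py (py u) p)) :=
    eq_neg_of_add_eq_zero_left he
  rw [fderiv_im_aux u (px u) hud (hxC.differentiable (by simp)),
    fderiv_im_aux u (py u) hud (hyC.differentiable (by simp)), he2]
  change _ = ((starRingEnd ℂ) (px u p) * px u p + (starRingEnd ℂ) (u p) * px (px u) p).im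
    + ((starRingEnd ℂ) (py u p) * py u p + (starRingEnd ℂ) (u p) * py (py u) p).im
  simp only [hu, Complex.mul_im, Complex.add_im, Complex.mul_re, Complex.add_re, Complex.neg_re,
    Complex.neg_im, Complex.I_re, Complex.I_im, Complex.conj_re, Complex.conj_im]
  ring
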